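/- arXiv:2104.03457 — 2 statements merged into one kernel-verified Lean document; each statement's English description precedes it below -/
import Mathlib

section
/- Let p ≡ 3 (mod 4), let e = 2m with m ≥ 1, suppose s divides m, and let b ∈ F_p^*. Then for i = 0, 1: ψ_4^{(i)}(0, b) = -((p-1)/2) p^{e+m-3} if m/s ≡ 1 (mod 2), and ψ_4^{(i)}(0, b) = -((p-1)/2) p^{e+m+s-3} if m/s ≡ 0 (mod 2). -/
open scoped BigOperators

noncomputable section

/-- The primitive `p`-th root of unity `ζ_p = exp(2πi/p)`. -/
def zetaP (p : ℕ) : ℂ := Complex.exp (2 * Real.pi * Complex.I / p)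

/-- The absolute trace map from `F_q = GF(p^e)` onto `F_p`. -/
def tr (p e : ℕ) [Fact p.Prime] (x : GaloisField p e) : ZMod p :=
  Algebra.trace (ZMod p) (GaloisField p e) x

/-- The Weil sum `S(α, β) = Σ_{x ∈ F_q} ζ_p^{Tr(α x^{p^l+1} + β x)}`. -/
def weilSum (p e l : ℕ) [Fact p.Prime] (α β : GaloisField p e) : ℂ :=
  letI : Fintype (GaloisField p e) := Fintype.ofFinite _
  ∑ x : GaloisField p e, zetaP p ^ (tr p e (α * x ^ (p ^ l + 1) + β * x)).val

/- The quadratic character `η` of `F_p`, integer-valued: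
`η(0) = 0`, `η(x) = 1` for nonzero squares, `η(x) = -1` for nonsquares. -/
open Classical in
def eta (p : ℕ) (x : ZMod p) : ℤ :=
  if x = 0 then 0 else if IsSquare x then 1 else -1

/- The cyclotomic classes of order 2 in `F_p^*`: `cyc p 0` is the set of nonzero
squares `C_0^{(2,p)}`, and `cyc p 1` is the set of nonsquares `C_1^{(2,p)}`. -/
open Classical in
def cyc (p : ℕ) [Fact p.Prime] (i : ℕ) : Finset (ZMod p) :=
  Finset.univ.filter (fun x => x ≠ 0 ∧ (if i = 0 then IsSquare x else ¬ IsSquare x))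

/-- `ψ_3(a) = ((p-1)/2) p^{e-3} Σ_{z1 ∈ F_p^*} ζ_p^{-z1} Σ_{z3 ∈ F_p^*} S(z1, a z3)`. -/
def psi3 (p e l : ℕ) [Fact p.Prime] (a : GaloisField p e) : ℂ :=
  ((p : ℂ) - 1) / 2 * (p : ℂ) ^ ((e : ℤ) - 3) *
    ∑ z1 ∈ ({0}ᶜ : Finset (ZMod p)), zetaP p ^ (-z1).val *
      ∑ z3 ∈ ({0}ᶜ : Finset (ZMod p)),
        weilSum p e l (algebraMap (ZMod p) (GaloisField p e) z1)
          (a * algebraMap (ZMod p) (GaloisField p e) z3)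

/-- `ψ_4^{(i)}(a, b) = p^{e-3} Σ_{c ∈ C_i} Σ_{z1 ∈ F_p^*} ζ_p^{-z1}
      Σ_{z2 ∈ F_p^*} ζ_p^{-c z2} S(z1, -a b⁻¹ z2)`, for `b ∈ F_p^*`. -/
def psi4 (p e l : ℕ) [Fact p.Prime] (i : ℕ) (a : GaloisField p e) (b : ZMod p) : ℂ :=
  (p : ℂ) ^ ((e : ℤ) - 3) *
    ∑ c ∈ cyc p i, ∑ z1 ∈ ({0}ᶜ : Finset (ZMod p)), zetaP p ^ (-z1).val *
      ∑ z2 ∈ ({0}ᶜ : Finset (ZMod p)), zetaP p ^ (-(c * z2)).val *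
        weilSum p e l (algebraMap (ZMod p) (GaloisField p e) z1)
          (-a * algebraMap (ZMod p) (GaloisField p e) (b⁻¹ * z2))

/-- `T_i(a,b) = |{(x1,x2) ∈ F_q² : Tr(x1^{p^l+1}) = 1, Tr(x2) ∈ C_i, Tr(a x1 + b x2) = 0}|`. -/
def Tcount (p e l : ℕ) [Fact p.Prime] (i : ℕ) (a b : GaloisField p e) : ℕ :=
  Nat.card {x : GaloisField p e × GaloisField p e //
    tr p e (x.1 ^ (p ^ l + 1)) = 1 ∧ tr p e x.2 ∈ cyc p i ∧ tr p e (a * x.1 + b * x.2) = 0}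

/-- The defining set `D_i = {(x1,x2) ∈ F_q² : Tr(x1^{p^l+1}) = 1, Tr(x2) ∈ C_i^{(2,p)}}`. -/
def Dset (p e l : ℕ) [Fact p.Prime] (i : ℕ) : Set (GaloisField p e × GaloisField p e) :=
  {x | tr p e (x.1 ^ (p ^ l + 1)) = 1 ∧ tr p e x.2 ∈ cyc p i}

/-- The codeword of `C_{D_i}` indexed by `(a, b) ∈ F_q²`:
the vector `(Tr(a x1 + b x2))_{(x1,x2) ∈ D_i}`. -/
def codeword (p e l : ℕ) [Fact p.Prime] (i : ℕ) (a b : GaloisField p e) :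
    Dset p e l i → ZMod p :=
  fun x => tr p e (a * x.1.1 + b * x.1.2)

/-- The linear code `C_{D_i} = {(Tr(a x1 + b x2))_{(x1,x2) ∈ D_i} : a, b ∈ F_q}`. -/
def code (p e l : ℕ) [Fact p.Prime] (i : ℕ) : Set (Dset p e l i → ZMod p) :=
  Set.range (fun ab : GaloisField p e × GaloisField p e => codeword p e l i ab.1 ab.2)

/-- The Hamming weight of a vector: the number of nonzero coordinates. -/
def wt {ι : Type*} {p : ℕ} (c : ι → ZMod p) : ℕ := Nat.card {x : ι // c x ≠ 0}

section helpers

lemma h_pow_iter {F : Type*} [Field F] (R : ℕ) (hR : Odd R) (x : F) (hx : x ^ R = -x) (n : ℕ) :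
    x ^ (R ^ n) = (-1) ^ n * x := by
  induction n with
  | zero => simp
  | succ n ih =>
    rw [pow_succ, pow_mul, ih, mul_pow, hx, ← pow_mul, mul_comm n R, pow_mul, hR.neg_one_pow]
    ring

lemma h_pow_iter_fix {F : Type*} [Field F] (R : ℕ) (x : F) (hx : x ^ R = x) (n : ℕ) :
    x ^ (R ^ n) = x := by
  induction n with
  | zero => simp
  | succ n ih => rw [pow_succ, pow_mul, ih, hx]

variable {F : Type*} [Field F] [Fintype F]

lemma rad_odd (Q k : ℕ) (hQ : Odd Q) (hk : Odd k) (h2 : (2 : F) ≠ 0)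
    (hq : Fintype.card F = Q ^ (2 * k)) (x : F) (hx : x ^ (Q ^ 2) = -x) : x = 0 := by
  have h := h_pow_iter (Q ^ 2) hQ.pow x hx k
  rw [← pow_mul, ← hq, FiniteField.pow_card, hk.neg_one_pow] at h
  have : 2 * x = 0 := by linear_combination h
  simpa [h2] using this

lemma rad_iff (Q k u : ℕ) (hQ : Odd Q) (hu : Odd u) (hk : 0 < k) (huk : Nat.Coprime u (2 * k))
    (hq : Fintype.card F = Q ^ (2 * k)) (x : F) :
    x ^ ((Q ^ u) ^ 2) = -x ↔ x ^ (Q ^ 2) = -x := by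
  constructor
  · intro h
    obtain ⟨v, -, hv⟩ := Nat.exists_mul_mod_eq_one_of_coprime huk (by omega)
    set t := u * v / (2 * k) with ht
    have huv : u * v = 2 * k * t + 1 := by
      have := Nat.div_add_mod (u * v) (2 * k)
      rw [hv] at this; exact this.symm
    have hvodd : Odd v := by
      have : Odd (u * v) := by rw [huv, mul_assoc]; exact odd_two_mul_add_one _
      exact (Nat.odd_mul.mp this).2
    have h1 := h_pow_iter ((Q ^ u) ^ 2) (hQ.pow.pow) x h v
    rw [hvodd.neg_one_pow, neg_one_mul] at h1
    rw [← h1]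
    have e1 : ((Q ^ u) ^ 2) ^ v = (Q ^ (2 * k)) ^ (2 * t) * Q ^ 2 := by
      rw [← pow_mul, ← pow_mul, ← pow_mul, ← pow_add]
      congr 1
      calc u * (2 * v) = 2 * (u * v) := by ring
        _ = _ := by rw [huv]; ring
    rw [e1, pow_mul, ← hq, FiniteField.pow_card_pow]
  · intro h
    have h1 := h_pow_iter (Q ^ 2) hQ.pow x h u
    rw [hu.neg_one_pow, neg_one_mul] at h1
    rw [← h1]; congr 1; ring

lemma rad_even [DecidableEq F] (Q k : ℕ) (hQ : Odd Q) (hQ1 : 1 < Q) (hk : Even k) (hk0 : 0 < k) (h2 : (2 : F) ≠ 0)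
    (hq : Fintype.card F = Q ^ (2 * k)) :
    (Finset.univ.filter (fun x : F => x ^ (Q ^ 2) = -x)).card = Q ^ 2 := by
  obtain ⟨g, hg⟩ := IsCyclic.exists_generator (α := Fˣ)
  have hord : orderOf g = Q ^ (2 * k) - 1 := by
    rw [orderOf_eq_card_of_forall_mem_zpowers hg, Nat.card_eq_fintype_card, Fintype.card_units, hq]
  have hQ2 : 1 < Q ^ 2 := Nat.one_lt_pow (by norm_num) hQ1
  obtain ⟨j, hj⟩ := hk
  have hd : 2 * (Q ^ 2 - 1) ∣ Q ^ (2 * k) - 1 := by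
    have h4 : Q ^ 4 - 1 ∣ Q ^ (2 * k) - 1 := by
      have : 2 * k = 4 * j := by omega
      rw [this, pow_mul]
      simpa using Nat.sub_dvd_pow_sub_pow (Q ^ 4) 1 j
    refine dvd_trans ?_ h4
    have : Q ^ 4 - 1 = (Q ^ 2 + 1) * (Q ^ 2 - 1) := by
      rw [show Q ^ 4 = (Q ^ 2) ^ 2 by ring]
      simpa using Nat.sq_sub_sq (Q ^ 2) 1
    rw [this]
    apply Nat.mul_dvd_mul_right
    have : Odd (Q ^ 2) := hQ.pow
    exact (this.add_one).two_dvd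
  obtain ⟨c, hc⟩ := hd
  have hqpos : 0 < Q ^ (2 * k) - 1 := by
    have : 1 < Q ^ (2 * k) := Nat.one_lt_pow (by omega) hQ1
    omega
  have hx0 : ((g ^ c : Fˣ) : F) ^ (Q ^ 2 - 1) = -1 := by
    have hsq : ((((g ^ c : Fˣ) : F)) ^ (Q ^ 2 - 1)) ^ 2 = 1 := by
      rw [← Units.val_pow_eq_pow_val, ← Units.val_pow_eq_pow_val, ← pow_mul, ← pow_mul,
        show c * ((Q ^ 2 - 1) * 2) = orderOf g by rw [hord, hc]; ring, pow_orderOf_eq_one]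
      simp
    rcases sq_eq_one_iff.mp hsq with h | h
    · exfalso
      have h' : g ^ (c * (Q ^ 2 - 1)) = 1 := by
        ext; rw [pow_mul]; simpa using h
      have := orderOf_dvd_of_pow_eq_one h'
      rw [hord, hc] at this
      have hpos : 0 < c * (Q ^ 2 - 1) := by
        rcases Nat.eq_zero_or_pos (c * (Q ^ 2 - 1)) with h0 | h0
        · rw [hc, mul_assoc, mul_comm _ c, h0] at hqpos; omega
        · exact h0
      have := Nat.le_of_dvd hpos this
      nlinarith
    · exact h
  set x0 : F := ((g ^ c : Fˣ) : F) with hx0d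
  have hx0' : x0 ^ (Q ^ 2) = -x0 := by
    rw [show Q ^ 2 = (Q ^ 2 - 1) + 1 by omega, pow_succ, hx0]; ring
  have hne : x0 ≠ 0 := Units.ne_zero _
  have hcardfix : (Finset.univ.filter (fun x : F => x ^ (Q ^ 2) = x)).card = Q ^ 2 := by
    have hker := IsCyclic.card_powMonoidHom_ker (G := Fˣ) (Q ^ 2 - 1)
    have hgcd : (Nat.card Fˣ).gcd (Q ^ 2 - 1) = Q ^ 2 - 1 := by
      apply Nat.gcd_eq_right
      rw [Nat.card_eq_fintype_card, Fintype.card_units, hq, hc]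
      exact ⟨2 * c, by ring⟩
    rw [hgcd] at hker
    have e : (Finset.univ.filter (fun x : F => x ^ (Q ^ 2) = x)) =
        insert 0 ((Finset.univ.filter (fun x : Fˣ => x ∈ (powMonoidHom (Q ^ 2 - 1) : Fˣ →* Fˣ).ker)).map
          ⟨Units.val, Units.val_injective⟩) := by
      ext x
      simp only [Finset.mem_filter, Finset.mem_univ, true_and, Finset.mem_insert, Finset.mem_map,
        MonoidHom.mem_ker, powMonoidHom_apply, Function.Embedding.coeFn_mk]
      constructor
      · intro h
        by_cases hx : x = 0
        · exact Or.inl hx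
        · right
          refine ⟨Units.mk0 x hx, ?_, rfl⟩
          ext
          simp only [Units.val_pow_eq_pow_val, Units.val_mk0, Units.val_one]
          rw [show Q ^ 2 = (Q ^ 2 - 1) + 1 by omega, pow_succ] at h
          exact mul_right_cancel₀ hx (by rw [h, one_mul])
      · rintro (h | ⟨a, ha, rfl⟩)
        · rw [h, zero_pow (by omega)]
        · rw [show Q ^ 2 = (Q ^ 2 - 1) + 1 by omega, pow_succ, ← Units.val_pow_eq_pow_val, ha]; simp
    rw [e, Finset.card_insert_of_notMem (by simp), Finset.card_map]
    rw [← Fintype.card_subtype, ← Nat.card_eq_fintype_card]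
    have : Nat.card {x : Fˣ // x ∈ (powMonoidHom (Q ^ 2 - 1) : Fˣ →* Fˣ).ker} = Q ^ 2 - 1 := hker
    rw [this]; omega
  refine Eq.trans ?_ hcardfix
  symm
  apply Finset.card_bij (fun y _ => x0 * y)
  · intro y hy
    simp only [Finset.mem_filter, Finset.mem_univ, true_and] at hy ⊢
    rw [mul_pow, hy, hx0']; ring
  · intro a _ b _ h
    exact mul_left_cancel₀ hne h
  · intro y hy
    simp only [Finset.mem_filter, Finset.mem_univ, true_and] at hy
    refine ⟨x0⁻¹ * y, ?_, by field_simp⟩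
    simp only [Finset.mem_filter, Finset.mem_univ, true_and]
    rw [mul_pow, hy, inv_pow, hx0']; field_simp

/-- nonzero elements of the prime field are `(Q^u+1)`-th powers. -/
lemma exists_norm_root [DecidableEq F] (Q k u : ℕ) (hQ1 : 1 < Q) (hu : Odd u)
    (hq : Fintype.card F = Q ^ (2 * k)) (c : F) (hc0 : c ≠ 0) (hc : c ^ (Q - 1) = 1) :
    ∃ y : F, y ≠ 0 ∧ y ^ (Q ^ u + 1) = c := by
  obtain ⟨g, hg⟩ := IsCyclic.exists_generator (α := Fˣ)
  have hord : orderOf g = Q ^ (2 * k) - 1 := by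
    rw [orderOf_eq_card_of_forall_mem_zpowers hg, Nat.card_eq_fintype_card, Fintype.card_units, hq]
  obtain ⟨T, hT⟩ : Q ^ 2 - 1 ∣ Q ^ (2 * k) - 1 := by
    rw [pow_mul]; simpa using Nat.sub_dvd_pow_sub_pow (Q ^ 2) 1 k
  have hfac : Q ^ 2 - 1 = (Q + 1) * (Q - 1) := by simpa using Nat.sq_sub_sq Q 1
  obtain ⟨j, hj⟩ := (mem_powers_iff_mem_zpowers (x := g) (y := Units.mk0 c hc0)).mpr (hg _)
  simp only at hj
  have h1 : g ^ (j * (Q - 1)) = 1 := by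
    rw [pow_mul, hj]; ext; simpa using hc
  have h2 := orderOf_dvd_of_pow_eq_one h1
  rw [hord, hT, hfac] at h2
  have hQ' : 0 < Q - 1 := by omega
  have h3 : (Q + 1) * T ∣ j := by
    apply Nat.dvd_of_mul_dvd_mul_right hQ'
    convert h2 using 1; ring
  obtain ⟨i, rfl⟩ := h3
  have hy1 : (g ^ (T * i)) ^ (Q ^ 2 - 1) = 1 := by
    rw [← pow_mul, show T * i * (Q ^ 2 - 1) = orderOf g * i by rw [hord, hT]; ring, pow_mul,
      pow_orderOf_eq_one, one_pow]
  have hy2 : ((g ^ (T * i) : Fˣ) : F) ^ (Q ^ 2) = ((g ^ (T * i) : Fˣ) : F) := by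
    have : 1 < Q ^ 2 := Nat.one_lt_pow (by norm_num) hQ1
    rw [show Q ^ 2 = (Q ^ 2 - 1) + 1 by omega, pow_succ, ← Units.val_pow_eq_pow_val, hy1]; simp
  refine ⟨((g ^ (T * i) : Fˣ) : F), Units.ne_zero _, ?_⟩
  obtain ⟨w, rfl⟩ := hu
  rw [pow_succ, pow_succ, pow_mul Q 2 w, pow_mul, h_pow_iter_fix _ _ hy2, ← pow_succ,
    ← Units.val_pow_eq_pow_val, ← pow_mul, show T * i * (Q + 1) = (Q + 1) * T * i by ring, hj]
  simp

/-- counts of units satisfying a condition depending only on the `(Q^u+1)`-th power. -/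
lemma count_dvd (Q k u : ℕ) (hu : Odd u)
    (hq : Fintype.card F = Q ^ (2 * k)) (A : F → Prop) [DecidablePred A] [DecidableEq F] :
    Q + 1 ∣ (Finset.univ.filter (fun x : Fˣ => A ((x : F) ^ (Q ^ u + 1)))).card := by
  set f : Fˣ →* Fˣ := powMonoidHom (Q + 1)
  have hker : (Finset.univ.filter (fun x : Fˣ => f x = 1)).card = Q + 1 := by
    have hker := IsCyclic.card_powMonoidHom_ker (G := Fˣ) (Q + 1)
    have hgcd : (Nat.card Fˣ).gcd (Q + 1) = Q + 1 := by
      apply Nat.gcd_eq_right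
      rw [Nat.card_eq_fintype_card, Fintype.card_units, hq, pow_mul]
      refine dvd_trans ?_ (by simpa using Nat.sub_dvd_pow_sub_pow (Q ^ 2) 1 k)
      exact ⟨Q - 1, by simpa using Nat.sq_sub_sq Q 1⟩
    rw [hgcd] at hker
    rw [← Fintype.card_subtype, ← Nat.card_eq_fintype_card]
    exact hker
  rw [Finset.card_eq_sum_card_image f]
  apply Finset.dvd_sum
  intro b hb
  obtain ⟨a, ha, rfl⟩ := Finset.mem_image.mp hb
  simp only [Finset.mem_filter, Finset.mem_univ, true_and] at ha
  obtain ⟨w, hw⟩ : Q + 1 ∣ Q ^ u + 1 := by simpa using hu.nat_add_dvd_pow_add_pow Q 1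
  have : (Finset.filter (fun x => f x = f a)
      (Finset.univ.filter (fun x : Fˣ => A ((x : F) ^ (Q ^ u + 1))))).card = Q + 1 := by
    rw [← hker]
    symm
    apply Finset.card_bij (fun y _ => y * a)
    · intro y hy
      simp only [Finset.mem_filter, Finset.mem_univ, true_and] at hy ⊢
      refine ⟨?_, by rw [map_mul, hy, one_mul]⟩
      have : y ^ (Q ^ u + 1) = 1 := by
        rw [hw, pow_mul]
        have : y ^ (Q + 1) = 1 := hy
        rw [this, one_pow]
      rw [Units.val_mul, mul_pow, ← Units.val_pow_eq_pow_val, this]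
      simpa using ha
    · intro x _ y _ h
      exact mul_right_cancel h
    · intro y hy
      simp only [Finset.mem_filter, Finset.mem_univ, true_and] at hy
      refine ⟨y * a⁻¹, ?_, by simp⟩
      simp [hy.2]
  rw [this]

lemma int_final (Q r : ℕ) (n : ℤ) (hQ : 1 < Q) (hr : Odd r) (hn : n ^ 2 = ((Q : ℤ) ^ r) ^ 2)
    (h1 : (Q + 1 : ℤ) ∣ n - 1) : n = -(Q : ℤ) ^ r := by
  rcases sq_eq_sq_iff_eq_or_eq_neg.mp hn with h | h
  · exfalso
    have h2 : (Q + 1 : ℤ) ∣ (Q : ℤ) ^ r + 1 := by simpa using hr.add_dvd_pow_add_pow (Q : ℤ) 1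
    rw [h] at h1
    have h3 : (Q + 1 : ℤ) ∣ 2 := by
      have := dvd_sub h2 h1
      ring_nf at this ⊢; exact this
    have := Int.le_of_dvd (by norm_num) h3
    omega
  · exact h

end helpers

section charsum

lemma zetaP_pow_val (p : ℕ) [Fact p.Prime] (x : ZMod p) :
    zetaP p ^ x.val = ZMod.stdAddChar x := by
  rw [ZMod.stdAddChar_apply, ZMod.toCircle_apply, zetaP, ← Complex.exp_nat_mul]
  congr 1; ring

lemma sum_std_mul (p : ℕ) [Fact p.Prime] (c : ZMod p) (hc : c ≠ 0) :
    ∑ z ∈ ({0}ᶜ : Finset (ZMod p)), (ZMod.stdAddChar (z * c) : ℂ) = -1 := by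
  have h := AddChar.sum_mulShift c (ZMod.isPrimitive_stdAddChar p)
  rw [if_neg hc, ← Finset.sum_compl_add_sum ({0} : Finset (ZMod p))] at h
  simp only [Finset.sum_singleton, zero_mul, AddChar.map_zero_eq_one] at h
  rw [Nat.cast_zero] at h
  exact eq_neg_of_add_eq_zero_left h

variable {p : ℕ} [Fact p.Prime] {F : Type*} [Field F] [Fintype F] [Algebra (ZMod p) F]

/-- the canonical additive character -/
def psiF (p : ℕ) [Fact p.Prime] (F : Type*) [Field F] [Algebra (ZMod p) F] : AddChar F ℂ :=
  (ZMod.stdAddChar (N := p)).compAddMonoidHom (Algebra.trace (ZMod p) F).toAddMonoidHom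

lemma psiF_apply (x : F) : psiF p F x = ZMod.stdAddChar (Algebra.trace (ZMod p) F x) := rfl

lemma psiF_prim : (psiF p F).IsPrimitive := by
  apply AddChar.IsPrimitive.of_ne_one
  intro h
  obtain ⟨x, hx⟩ := Algebra.trace_surjective (ZMod p) F 1
  have h1 : psiF p F x = 1 := by rw [h]; rfl
  rw [psiF_apply, hx] at h1
  have := ZMod.injective_stdAddChar (N := p) (h1.trans (AddChar.map_zero_eq_one _).symm)
  exact one_ne_zero this

lemma trace_frob (x : F) : Algebra.trace (ZMod p) F (x ^ p) = Algebra.trace (ZMod p) F x := by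
  have := Algebra.trace_eq_of_algEquiv (FiniteField.frobeniusAlgEquivOfAlgebraic (ZMod p) F) x
  rw [FiniteField.coe_frobeniusAlgEquivOfAlgebraic] at this
  simpa [ZMod.card] using this

lemma trace_frob_pow (n : ℕ) (x : F) :
    Algebra.trace (ZMod p) F (x ^ p ^ n) = Algebra.trace (ZMod p) F x := by
  induction n with
  | zero => simp
  | succ n ih => rw [pow_succ, pow_mul, trace_frob, ih]

lemma sum_mul_shift_pow [DecidableEq F] (n : ℕ) (h : F) :
    ∑ y : F, psiF p F (y ^ p ^ n * h) = if h = 0 then (Fintype.card F : ℂ) else 0 := by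
  have := AddChar.sum_mulShift h (psiF_prim (p := p) (F := F))
  have hchar : CharP F p := charP_of_injective_algebraMap (algebraMap (ZMod p) F).injective p
  have hb : Function.Bijective (fun y : F => y ^ p ^ n) := by
    rw [← Finite.injective_iff_bijective]
    exact (iterateFrobenius F p n).injective
  rw [← Function.Bijective.sum_comp hb] at this
  rw [this]; split_ifs <;> simp

/-- Product of the Weil sum with its conjugate. -/
lemma sum_sq [DecidableEq F] (hp2 : p ≠ 2) (n : ℕ) :
    (∑ x : F, psiF p F (x ^ (p ^ n + 1))) * (∑ x : F, psiF p F (-(x ^ (p ^ n + 1)))) =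
      (Fintype.card F : ℂ) *
        (Finset.univ.filter (fun x : F => x ^ ((p ^ n) ^ 2) = -x)).card := by
  have hchar : CharP F p := charP_of_injective_algebraMap (algebraMap (ZMod p) F).injective p
  have key : ∀ h y : F, psiF p F ((y + h) ^ (p ^ n + 1)) * psiF p F (-(y ^ (p ^ n + 1))) =
      psiF p F (h ^ (p ^ n + 1)) * psiF p F (y ^ p ^ n * (h + h ^ ((p ^ n) ^ 2))) := by
    intro h y
    rw [← AddChar.map_add_eq_mul, ← AddChar.map_add_eq_mul, psiF_apply, psiF_apply]
    congr 1
    have e1 : (y + h) ^ (p ^ n + 1) + -(y ^ (p ^ n + 1)) =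
        h ^ (p ^ n + 1) + (y ^ p ^ n * h) + y * h ^ p ^ n := by
      rw [pow_succ, add_pow_char_pow]; ring
    have e2 : y ^ p ^ n * h ^ ((p ^ n) ^ 2) = (y * h ^ p ^ n) ^ p ^ n := by
      rw [mul_pow, ← pow_mul h, sq (p ^ n)]
    rw [e1, mul_add, e2]
    simp only [map_add, trace_frob_pow]
    ring
  calc _ = ∑ y : F, ∑ h : F, psiF p F ((y + h) ^ (p ^ n + 1)) * psiF p F (-(y ^ (p ^ n + 1))) := by
        rw [Finset.mul_sum]
        refine Finset.sum_congr rfl fun y _ => ?_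
        rw [Finset.sum_mul]
        exact (Equiv.sum_comp (Equiv.addLeft y)
          (fun x => psiF p F (x ^ (p ^ n + 1)) * psiF p F (-(y ^ (p ^ n + 1))))).symm
    _ = ∑ h : F, psiF p F (h ^ (p ^ n + 1)) *
          ∑ y : F, psiF p F (y ^ p ^ n * (h + h ^ ((p ^ n) ^ 2))) := by
        rw [Finset.sum_comm]
        simp only [key, Finset.mul_sum]
    _ = ∑ h : F, if h ^ ((p ^ n) ^ 2) = -h then (Fintype.card F : ℂ) else 0 := by
        refine Finset.sum_congr rfl fun h _ => ?_
        rw [sum_mul_shift_pow]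
        by_cases hh : h ^ ((p ^ n) ^ 2) = -h
        · rw [if_pos (by rw [hh]; ring), if_pos hh, psiF_apply]
          have e : (h ^ (p ^ n + 1)) ^ p ^ n = -(h ^ (p ^ n + 1)) := by
            rw [← pow_mul, add_mul, one_mul, pow_add, ← sq, hh]; ring
          have t := trace_frob_pow (p := p) n (h ^ (p ^ n + 1))
          rw [e, map_neg] at t
          have h2 : (2 : ZMod p) ≠ 0 := Ring.two_ne_zero (by rwa [ZMod.ringChar_zmod_n])
          have : (2 : ZMod p) * Algebra.trace (ZMod p) F (h ^ (p ^ n + 1)) = 0 := by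
            linear_combination -t
          rw [(mul_eq_zero.mp this).resolve_left h2]; simp
        · rw [if_neg (fun h0 => hh (by linear_combination h0)), if_neg hh, mul_zero]
    _ = _ := by
        rw [← Finset.sum_filter, Finset.sum_const, nsmul_eq_mul, mul_comm]

lemma sum_scale (P : ℕ) (c y : F) (hy0 : y ≠ 0) (hy : y ^ (P + 1) = c) :
    ∑ x : F, psiF p F (c * x ^ (P + 1)) = ∑ x : F, psiF p F (x ^ (P + 1)) := by
  rw [← Equiv.sum_comp (Equiv.mulLeft₀ y hy0) (fun x => psiF p F (x ^ (P + 1)))]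
  simp [mul_pow, hy]

/-- The Weil sum is an integer. -/
lemma sum_int [DecidableEq F] (P : ℕ)
    (hroot : ∀ c : ZMod p, c ≠ 0 → ∃ y : F, y ≠ 0 ∧ y ^ (P + 1) = algebraMap (ZMod p) F c) :
    ∑ x : F, psiF p F (x ^ (P + 1)) =
      ((Finset.univ.filter (fun x : F => Algebra.trace (ZMod p) F (x ^ (P + 1)) = 0)).card : ℂ) -
      ((Finset.univ.filter (fun x : F => Algebra.trace (ZMod p) F (x ^ (P + 1)) = 1)).card : ℂ) := by
  have hN : ∀ c : ZMod p, c ≠ 0 →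
      (Finset.univ.filter (fun x : F => Algebra.trace (ZMod p) F (x ^ (P + 1)) = c)).card =
      (Finset.univ.filter (fun x : F => Algebra.trace (ZMod p) F (x ^ (P + 1)) = 1)).card := by
    intro c hc
    obtain ⟨y, hy0, hy⟩ := hroot c hc
    symm
    have htr : ∀ x : F, Algebra.trace (ZMod p) F ((y * x) ^ (P + 1)) =
        c * Algebra.trace (ZMod p) F (x ^ (P + 1)) := by
      intro x
      rw [mul_pow, hy, ← Algebra.smul_def, map_smul, smul_eq_mul]
    apply Finset.card_bij (fun x _ => y * x)
    · intro x hx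
      simp only [Finset.mem_filter, Finset.mem_univ, true_and] at hx ⊢
      rw [htr, hx, mul_one]
    · intro a _ b _ h
      exact mul_left_cancel₀ hy0 h
    · intro x hx
      simp only [Finset.mem_filter, Finset.mem_univ, true_and] at hx
      refine ⟨y⁻¹ * x, ?_, by field_simp⟩
      simp only [Finset.mem_filter, Finset.mem_univ, true_and]
      have := htr (y⁻¹ * x)
      rw [mul_inv_cancel_left₀ hy0, hx] at this
      exact mul_left_cancel₀ hc (by rw [← this, mul_one])
  have e1 : ∑ x : F, psiF p F (x ^ (P + 1)) = ∑ c : ZMod p,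
      ((Finset.univ.filter (fun x : F => Algebra.trace (ZMod p) F (x ^ (P + 1)) = c)).card : ℂ) *
        ZMod.stdAddChar c := by
    rw [← Finset.sum_fiberwise Finset.univ (fun x : F => Algebra.trace (ZMod p) F (x ^ (P + 1)))]
    refine Finset.sum_congr rfl fun c _ => ?_
    rw [← nsmul_eq_mul, ← Finset.sum_const]
    refine Finset.sum_congr rfl fun x hx => ?_
    simp only [Finset.mem_filter, Finset.mem_univ, true_and] at hx
    rw [psiF_apply, hx]
  rw [e1, ← Finset.sum_compl_add_sum ({0} : Finset (ZMod p))]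
  have e2 : ∑ c ∈ ({0}ᶜ : Finset (ZMod p)),
      ((Finset.univ.filter (fun x : F => Algebra.trace (ZMod p) F (x ^ (P + 1)) = c)).card : ℂ) *
        ZMod.stdAddChar c =
      -((Finset.univ.filter (fun x : F => Algebra.trace (ZMod p) F (x ^ (P + 1)) = 1)).card : ℂ) := by
    have := sum_std_mul p 1 one_ne_zero
    rw [← mul_neg_one, ← this, Finset.mul_sum]
    refine Finset.sum_congr rfl fun c hc => ?_
    rw [hN c (by simpa using hc), mul_one]
  rw [e2]
  simp
  ring
end charsum

section final

lemma weil_eval {p : ℕ} [Fact p.Prime] {F : Type*} [Field F] [Fintype F] [DecidableEq F]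
    [Algebra (ZMod p) F] (hp2 : p ≠ 2) (s k u r : ℕ) (hs : 0 < s) (hk : 0 < k)
    (hu : Odd u) (huk : Nat.Coprime u (2 * k))
    (hr : (Odd k ∧ r = k) ∨ (Even k ∧ r = k + 1))
    (hq : Fintype.card F = (p ^ s) ^ (2 * k)) (c : ZMod p) (hc : c ≠ 0) :
    ∑ x : F, psiF p F (algebraMap (ZMod p) F c * x ^ (p ^ (s * u) + 1)) = -(p : ℂ) ^ (s * r) := by
  have hpp : p.Prime := Fact.out
  have hpo : Odd p := hpp.odd_of_ne_two hp2
  have hQo : Odd (p ^ s) := hpo.pow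
  have hQ1 : 1 < p ^ s := Nat.one_lt_pow (by omega) hpp.one_lt
  have hchar : CharP F p := charP_of_injective_algebraMap (algebraMap (ZMod p) F).injective p
  have h2 : (2 : F) ≠ 0 := Ring.two_ne_zero (by rwa [ringChar.eq F p])
  have hroot : ∀ c : ZMod p, c ≠ 0 →
      ∃ y : F, y ≠ 0 ∧ y ^ (p ^ (s * u) + 1) = algebraMap (ZMod p) F c := by
    intro c hc
    rw [pow_mul]
    refine exists_norm_root (p ^ s) k u hQ1 hu hq _ (by simpa using hc) ?_
    obtain ⟨t, ht⟩ : p - 1 ∣ p ^ s - 1 := by simpa using Nat.sub_dvd_pow_sub_pow p 1 s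
    rw [ht, ← map_pow, pow_mul, ZMod.pow_card_sub_one_eq_one hc, one_pow, map_one]
  have hscale : ∀ c : ZMod p, c ≠ 0 →
      ∑ x : F, psiF p F (algebraMap (ZMod p) F c * x ^ (p ^ (s * u) + 1)) =
        ∑ x : F, psiF p F (x ^ (p ^ (s * u) + 1)) := by
    intro c hc
    obtain ⟨y, hy0, hy⟩ := hroot c hc
    exact sum_scale _ _ y hy0 hy
  rw [hscale c hc]
  have hsq := sum_sq (p := p) (F := F) hp2 (s * u)
  have hneg := hscale (-1) (by simp)
  simp only [map_neg, map_one, neg_one_mul] at hneg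
  rw [hneg] at hsq
  have hint := sum_int (p := p) (F := F) (p ^ (s * u)) hroot
  -- the divisibility
  have hN1 : p ^ s + 1 ∣ (Finset.univ.filter
      (fun x : F => Algebra.trace (ZMod p) F (x ^ (p ^ (s * u) + 1)) = 1)).card := by
    have := count_dvd (p ^ s) k u hu hq (fun y : F => Algebra.trace (ZMod p) F y = 1)
    rw [← Finset.card_map ⟨Units.val, Units.val_injective⟩] at this
    convert this using 2
    ext x
    simp only [Finset.mem_filter, Finset.mem_univ, true_and, Finset.mem_map,
      Function.Embedding.coeFn_mk, ← pow_mul]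
    constructor
    · intro h
      have hx : x ≠ 0 := by
        rintro rfl
        simp at h
      exact ⟨Units.mk0 x hx, h, rfl⟩
    · rintro ⟨a, ha, rfl⟩
      exact ha
  have hN0 : ∃ t, (Finset.univ.filter
      (fun x : F => Algebra.trace (ZMod p) F (x ^ (p ^ (s * u) + 1)) = 0)).card =
        (p ^ s + 1) * t + 1 := by
    obtain ⟨t, ht⟩ := count_dvd (p ^ s) k u hu hq (fun y : F => Algebra.trace (ZMod p) F y = 0)
    refine ⟨t, ?_⟩
    rw [← ht, ← Finset.card_map ⟨Units.val, Units.val_injective⟩,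
      ← Finset.card_insert_of_notMem (a := (0 : F)) (by simp)]
    congr 1
    ext x
    simp only [Finset.mem_filter, Finset.mem_univ, true_and, Finset.mem_map, Finset.mem_insert,
      Function.Embedding.coeFn_mk, ← pow_mul]
    constructor
    · intro h
      by_cases hx : x = 0
      · exact Or.inl hx
      · exact Or.inr ⟨Units.mk0 x hx, h, rfl⟩
    · rintro (rfl | ⟨a, ha, rfl⟩)
      · simp
      · exact ha
  obtain ⟨t1, ht1⟩ := hN1
  obtain ⟨t0, ht0⟩ := hN0
  rw [ht1, ht0] at hint
  set n : ℤ := (((p ^ s + 1) * t0 + 1 : ℕ) : ℤ) - (((p ^ s + 1) * t1 : ℕ) : ℤ) with hn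
  have hintn : ∑ x : F, psiF p F (x ^ (p ^ (s * u) + 1)) = (n : ℂ) := by
    rw [hint, hn]; push_cast; ring
  rw [hintn] at hsq ⊢
  have hrodd : Odd r := by
    rcases hr with ⟨h, rfl⟩ | ⟨h, rfl⟩
    · exact h
    · exact h.add_one
  have hcard : (Finset.univ.filter (fun x : F => x ^ ((p ^ (s * u)) ^ 2) = -x)).card *
      (p ^ s) ^ (2 * k) = ((p ^ s) ^ r) ^ 2 := by
    have e : (Finset.univ.filter (fun x : F => x ^ ((p ^ (s * u)) ^ 2) = -x)) =
        Finset.univ.filter (fun x : F => x ^ ((p ^ s) ^ 2) = -x) := by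
      ext x
      simp only [Finset.mem_filter, Finset.mem_univ, true_and]
      rw [pow_mul p s u]
      exact rad_iff (p ^ s) k u hQo hu hk huk hq x
    rw [e]
    rcases hr with ⟨h, rfl⟩ | ⟨h, rfl⟩
    · have : Finset.univ.filter (fun x : F => x ^ ((p ^ s) ^ 2) = -x) = {0} := by
        ext x
        simp only [Finset.mem_filter, Finset.mem_univ, true_and, Finset.mem_singleton]
        constructor
        · exact rad_odd (p ^ s) r hQo h h2 hq x
        · rintro rfl
          rw [zero_pow (by positivity), neg_zero]
      rw [this, Finset.card_singleton]; ring
    · rw [rad_even (p ^ s) k hQo hQ1 h hk h2 hq]; ring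
  have hnsq : n ^ 2 = (((p ^ s : ℕ) : ℤ) ^ r) ^ 2 := by
    have h1 : ((n ^ 2 : ℤ) : ℂ) = (((((p ^ s : ℕ) : ℤ) ^ r) ^ 2 : ℤ) : ℂ) := by
      have h3 : (((Finset.univ.filter (fun x : F => x ^ ((p ^ (s * u)) ^ 2) = -x)).card *
        (p ^ s) ^ (2 * k) : ℕ) : ℂ) = ((((p ^ s) ^ r) ^ 2 : ℕ) : ℂ) := by rw [hcard]
      rw [hq] at hsq
      push_cast at hsq h3 ⊢
      rw [← h3, sq, hsq]; ring
    exact_mod_cast h1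
  have hdvd : (((p ^ s : ℕ) : ℤ) + 1) ∣ n - 1 := ⟨t0 - t1, by rw [hn]; push_cast; ring⟩
  rw [int_final (p ^ s) r n hQ1 hrodd hnsq hdvd]
  push_cast
  rw [← pow_mul]

lemma card_cyc (p : ℕ) [Fact p.Prime] (hp2 : p ≠ 2) (i : ℕ) :
    ((cyc p i).card : ℂ) = ((p : ℂ) - 1) / 2 := by
  classical
  have hpp : p.Prime := Fact.out
  obtain ⟨a, ha⟩ := FiniteField.exists_nonsquare (F := ZMod p) (by rwa [ZMod.ringChar_zmod_n])
  have ha0 : a ≠ 0 := by rintro rfl; exact ha (IsSquare.zero)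
  set A := Finset.univ.filter (fun x : ZMod p => x ≠ 0 ∧ IsSquare x) with hA
  set B := Finset.univ.filter (fun x : ZMod p => x ≠ 0 ∧ ¬ IsSquare x) with hB
  have hχ : ∀ x : ZMod p, x ≠ 0 → (IsSquare (a * x) ↔ ¬ IsSquare x) := by
    intro x hx
    have h1 := quadraticChar_neg_one_iff_not_isSquare.mpr ha
    rw [← quadraticChar_neg_one_iff_not_isSquare, ← quadraticChar_one_iff_isSquare
      (mul_ne_zero ha0 hx), map_mul, h1]
    constructor <;> intro h <;> linarith
  have hAB : A.card = B.card := by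
    apply Finset.card_bij (fun x _ => a * x)
    · intro x hx
      simp only [hA, hB, Finset.mem_filter, Finset.mem_univ, true_and] at hx ⊢
      exact ⟨mul_ne_zero ha0 hx.1, fun h => (hχ x hx.1).mp h hx.2⟩
    · intro x _ y _ h
      exact mul_left_cancel₀ ha0 h
    · intro y hy
      simp only [hB, Finset.mem_filter, Finset.mem_univ, true_and] at hy
      have h0 : a⁻¹ * y ≠ 0 := mul_ne_zero (inv_ne_zero ha0) hy.1
      refine ⟨a⁻¹ * y, ?_, by field_simp⟩
      simp only [hA, Finset.mem_filter, Finset.mem_univ, true_and]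
      refine ⟨h0, ?_⟩
      by_contra hns
      have := (hχ _ h0).mpr hns
      rw [mul_inv_cancel_left₀ ha0] at this
      exact hy.2 this
  have hsum : A.card + B.card = p - 1 := by
    have h1 := Finset.card_filter_add_card_filter_not (s := ({0}ᶜ : Finset (ZMod p)))
      (fun x => IsSquare x)
    rw [Finset.card_compl, ZMod.card, Finset.card_singleton] at h1
    rw [← h1]
    congr 2 <;> ext x <;> simp [hA, hB]
  have hsumC : (A.card : ℂ) + B.card = (p : ℂ) - 1 := by
    rw [← Nat.cast_add, hsum, Nat.cast_sub hpp.one_le, Nat.cast_one]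
  have hcase : (cyc p i).card = A.card := by
    by_cases hi : i = 0
    · simp [cyc, hi, hA]
    · rw [hAB]; simp [cyc, hi, hB]
  rw [hcase]
  rw [← hAB] at hsumC
  linear_combination hsumC / 2

lemma psi4_aux (p e l : ℕ) [Fact p.Prime] (hp2 : p ≠ 2) (i : ℕ) (b : ZMod p) (w : ℂ)
    (hw : ∀ z : ZMod p, z ≠ 0 →
      weilSum p e l (algebraMap (ZMod p) (GaloisField p e) z) 0 = -w) :
    psi4 p e l i 0 b = -(((p : ℂ) - 1) / 2) * ((p : ℂ) ^ ((e : ℤ) - 3) * w) := by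
  have hinner : ∀ c ∈ cyc p i, ∑ z1 ∈ ({0}ᶜ : Finset (ZMod p)), zetaP p ^ (-z1).val *
      ∑ z2 ∈ ({0}ᶜ : Finset (ZMod p)), zetaP p ^ (-(c * z2)).val *
        weilSum p e l (algebraMap (ZMod p) (GaloisField p e) z1)
          (-0 * algebraMap (ZMod p) (GaloisField p e) (b⁻¹ * z2)) = -w := by
    intro c hc
    have hc0 : c ≠ 0 := by
      simp only [cyc, Finset.mem_filter] at hc
      exact hc.2.1
    have h1 : ∀ z1 ∈ ({0}ᶜ : Finset (ZMod p)), zetaP p ^ (-z1).val *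
      ∑ z2 ∈ ({0}ᶜ : Finset (ZMod p)), zetaP p ^ (-(c * z2)).val *
        weilSum p e l (algebraMap (ZMod p) (GaloisField p e) z1)
          (-0 * algebraMap (ZMod p) (GaloisField p e) (b⁻¹ * z2)) =
        ZMod.stdAddChar (z1 * (-1)) * w := by
      intro z1 hz1
      rw [neg_zero]
      simp only [zero_mul]
      rw [hw z1 (by simpa using hz1), ← Finset.sum_mul]
      have h2 := sum_std_mul p (-c) (neg_ne_zero.mpr hc0)
      have h3 : ∑ z2 ∈ ({0}ᶜ : Finset (ZMod p)), zetaP p ^ (-(c * z2)).val = -1 := by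
        rw [← h2]
        refine Finset.sum_congr rfl fun z _ => ?_
        rw [zetaP_pow_val]; congr 1; ring
      rw [h3, zetaP_pow_val, mul_neg_one z1]; ring
    rw [Finset.sum_congr rfl h1, ← Finset.sum_mul, sum_std_mul p (-1) (by simp)]; ring
  rw [psi4, Finset.sum_congr rfl hinner, Finset.sum_const, nsmul_eq_mul, card_cyc p hp2]
  ring

end final

/-- the value of `ψ_4^{(i)}(0, b)` for `b ∈ F_p^*` (paper Lemma 12). -/
theorem psi4_zero_eval (p e l m s : ℕ) [Fact p.Prime] (hp : p % 4 = 3)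
    (hl : 0 < l) (hm : 1 ≤ m) (he : e = 2 * m) (hs : s = Nat.gcd l e) (hsm : s ∣ m)
    (b : ZMod p) (hb : b ≠ 0) :
    ∀ i ≤ 1,
      (Odd (m / s) →
        psi4 p e l i 0 b = -(((p : ℂ) - 1) / 2) * (p : ℂ) ^ ((e : ℤ) + m - 3)) ∧
      (Even (m / s) →
        psi4 p e l i 0 b = -(((p : ℂ) - 1) / 2) * (p : ℂ) ^ ((e : ℤ) + m + s - 3)) := by
  have hpp : p.Prime := Fact.out
  have hp2 : p ≠ 2 := by rintro rfl; omega
  have hs0 : 0 < s := by rw [hs]; exact Nat.gcd_pos_of_pos_left _ hl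
  obtain ⟨k, rfl⟩ := hsm
  have hk : 0 < k := Nat.pos_of_ne_zero (by rintro rfl; omega)
  obtain ⟨u, hu⟩ : s ∣ l := hs ▸ Nat.gcd_dvd_left l e
  have huk : Nat.Coprime u (2 * k) := by
    have h1 : s * 1 = s * Nat.gcd u (2 * k) := by
      rw [← Nat.gcd_mul_left, ← hu, show s * (2 * k) = e by rw [he]; ring, ← hs, mul_one]
    exact (Nat.eq_of_mul_eq_mul_left hs0 h1).symm
  have huo : Odd u := by
    rw [← Nat.coprime_two_right]
    exact Nat.Coprime.coprime_dvd_right ⟨k, rfl⟩ huk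
  have he0 : e ≠ 0 := by omega
  have hp0 : (p : ℂ) ≠ 0 := by exact_mod_cast hpp.ne_zero
  have hweil : ∀ r : ℕ, ((Odd k ∧ r = k) ∨ (Even k ∧ r = k + 1)) → ∀ z : ZMod p, z ≠ 0 →
      weilSum p e l (algebraMap (ZMod p) (GaloisField p e) z) 0 = -((p : ℂ) ^ (s * r)) := by
    intro r hr z hz
    classical
    letI : Fintype (GaloisField p e) := Fintype.ofFinite _
    have hq : Fintype.card (GaloisField p e) = (p ^ s) ^ (2 * k) := by
      rw [← Nat.card_eq_fintype_card, GaloisField.card p e he0, ← pow_mul, he]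
      congr 1; ring
    rw [← weil_eval (F := GaloisField p e) hp2 s k u r hs0 hk huo huk hr hq z hz, ← hu]
    unfold weilSum
    refine Finset.sum_congr rfl fun x _ => ?_
    rw [zetaP_pow_val, psiF_apply, zero_mul, add_zero]
    rfl
  intro i _
  rw [Nat.mul_div_cancel_left k hs0]
  constructor
  · intro hodd
    rw [psi4_aux p e l hp2 i b _ (hweil k (Or.inl ⟨hodd, rfl⟩)), ← zpow_natCast, ← zpow_add₀ hp0]
    congr 2; push_cast; ring
  · intro heven
    rw [psi4_aux p e l hp2 i b _ (hweil (k + 1) (Or.inr ⟨heven, rfl⟩)), ← zpow_natCast,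
      ← zpow_add₀ hp0]
    congr 2; push_cast; ring

end
end

section
/- Let p ≡ 3 (mod 4), let e = 2m with m ≥ 1, suppose s divides m and m/s ≡ 1 (mod 2), and let a ∈ F_q with a ≠ 0 and b ∈ F_p^*. Then the equation X^{p^{2l}} + X = -a^{p^l} has a unique solution γ in F_q, and for i = 0, 1: ψ_4^{(i)}(a, b) = -((p-1)/2) p^{e+m-3} if Tr(γ^{p^l+1}) = 0 or Tr(γ^{p^l+1}) ∈ C_0^{(2,p)}, and ψ_4^{(i)}(a, b) = ((p+1)/2) p^{e+m-3} if Tr(γ^{p^l+1}) ∈ C_1^{(2,p)}. -/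
open scoped BigOperators

noncomputable section

section helpers
set_option linter.unusedSectionVars false
variable {p : ℕ} [Fact p.Prime] {F : Type*} [Field F] [Fintype F] [Algebra (ZMod p) F] [CharP F p]

/-- trace composed with the standard character -/
lemma aux_trace_pow (l : ℕ) (x : F) :
    Algebra.trace (ZMod p) F (x ^ p ^ l) = Algebra.trace (ZMod p) F x := by
  induction l with
  | zero => simp
  | succ n ih =>
    have h := Algebra.trace_eq_of_algEquiv (FiniteField.frobeniusAlgEquivOfAlgebraic (ZMod p) F) (x ^ p ^ n)
    rw [← ih, ← h]
    simp [pow_succ, pow_mul, ZMod.card]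

lemma aux_pow_add (l : ℕ) (x y : F) : (x + y) ^ p ^ l = x ^ p ^ l + y ^ p ^ l :=
  add_pow_char_pow x y p l

lemma aux_pow_neg (l : ℕ) (x : F) : (-x) ^ p ^ l = -(x ^ p ^ l) := by
  have := aux_pow_add (p := p) l x (-x)
  rw [add_neg_cancel, zero_pow (pow_ne_zero _ (Fact.out : p.Prime).ne_zero)] at this
  exact (neg_eq_of_add_eq_zero_right this.symm).symm

lemma aux_pow_map (l : ℕ) (z : ZMod p) :
    (algebraMap (ZMod p) F z) ^ p ^ l = algebraMap (ZMod p) F z := by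
  rw [← map_pow, ZMod.pow_card_pow]

lemma aux_pow_bij (l : ℕ) : Function.Bijective (fun x : F => x ^ p ^ l) := by
  apply Finite.injective_iff_bijective.mp
  intro x y h
  exact iterateFrobenius_inj F p l (by simpa [iterateFrobenius_def] using h)

open Classical in
lemma aux_sum (c : F) : ∑ x : F, ZMod.stdAddChar (Algebra.trace (ZMod p) F (c * x)) =
    if c = 0 then (Fintype.card F : ℂ) else 0 := by
  classical
  split_ifs with h
  · simp [h]
  · let ψ : AddChar F ℂ := (ZMod.stdAddChar (N := p)).compAddMonoidHom
      ((Algebra.trace (ZMod p) F).toAddMonoidHom.comp (AddMonoidHom.mulLeft c))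
    have hψ : ψ ≠ 0 := by
      obtain ⟨b, hb⟩ : ∃ b : F, Algebra.trace (ZMod p) F (c * b) ≠ 0 := by
        have htr := (traceForm_nondegenerate (ZMod p) F).1 c
        simp_rw [Algebra.traceForm_apply] at htr
        by_contra! hf
        exact h (htr hf)
      intro h0
      have h1 : ψ b = 1 := by rw [h0]; rfl
      apply hb
      apply ZMod.injective_stdAddChar
      rw [AddChar.map_zero_eq_one]
      exact h1
    exact AddChar.sum_eq_zero_iff_ne_zero.mpr hψ

open Classical in
lemma aux_sum_pow (l : ℕ) (c : F) :
    ∑ x : F, ZMod.stdAddChar (Algebra.trace (ZMod p) F (x ^ p ^ l * c)) =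
    if c = 0 then (Fintype.card F : ℂ) else 0 := by
  rw [← aux_sum (p := p) c]
  refine Fintype.sum_bijective _ (aux_pow_bij (p := p) l) _ _ fun x => ?_
  rw [mul_comm]

lemma aux_iter (l n : ℕ) (x : F) (h : x ^ p ^ l = -x) : x ^ p ^ (l * n) = (-1) ^ n * x := by
  induction n with
  | zero => simp
  | succ n ih =>
    rw [Nat.mul_succ, pow_add, pow_mul, ih, mul_pow, h]
    have : ((-1 : F) ^ n) ^ p ^ l = (-1) ^ n := by
      rw [← pow_mul, mul_comm, pow_mul, aux_pow_neg, one_pow]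
    rw [this]; ring

lemma aux_fix (e k : ℕ) (hq : Fintype.card F = p ^ e) (x : F) : x ^ p ^ (e * k) = x := by
  rw [pow_mul, ← hq, FiniteField.pow_card_pow]

lemma aux_inj (hp : p ≠ 2) (e l n k : ℕ) (hq : Fintype.card F = p ^ e) (hn : Odd n)
    (hk : 2 * l * n = e * k) (x : F) (h : x ^ p ^ (2 * l) + x = 0) : x = 0 := by
  have h1 := aux_iter (p := p) (2 * l) n x (eq_neg_of_add_eq_zero_left h)
  rw [hk, aux_fix e k hq, hn.neg_one_pow] at h1
  have h2 : (2 : F) * x = 0 := by linear_combination h1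
  have h3 : (2 : F) ≠ 0 := Ring.two_ne_zero (by rwa [ringChar.eq F p])
  simpa [h3] using h2

lemma aux_bij (hp : p ≠ 2) (e l n k : ℕ) (hq : Fintype.card F = p ^ e) (hn : Odd n)
    (hk : 2 * l * n = e * k) : Function.Bijective (fun x : F => x ^ p ^ (2 * l) + x) := by
  apply Finite.injective_iff_bijective.mp
  intro x y h
  have hxy : x ^ p ^ (2 * l) + x = y ^ p ^ (2 * l) + y := h
  rw [← sub_eq_zero]
  apply aux_inj hp e l n k hq hn hk
  rw [sub_eq_add_neg, aux_pow_add, aux_pow_neg]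
  linear_combination hxy

/-- complete the square -/
lemma aux_shift (l : ℕ) (z : ZMod p) (β x₀ : F)
    (h : algebraMap (ZMod p) F z * (x₀ ^ p ^ (2 * l) + x₀) = -β ^ p ^ l) (y : F) :
    Algebra.trace (ZMod p) F (algebraMap (ZMod p) F z * (y + x₀) ^ (p ^ l + 1) + β * (y + x₀)) =
    z * Algebra.trace (ZMod p) F (y ^ (p ^ l + 1))
      - z * Algebra.trace (ZMod p) F (x₀ ^ (p ^ l + 1)) := by
  have e1 : algebraMap (ZMod p) F z * (y + x₀) ^ (p ^ l + 1) + β * (y + x₀) =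
     z • y ^ (p ^ l + 1) + z • x₀ ^ (p ^ l + 1) + (z • (y ^ p ^ l * x₀) + z • (x₀ ^ p ^ l * y)
      + β * y) + β * x₀ := by
    rw [pow_succ, aux_pow_add]
    simp only [Algebra.smul_def]; ring
  have e2 : Algebra.trace (ZMod p) F (x₀ ^ p ^ l * y) =
      Algebra.trace (ZMod p) F (x₀ ^ p ^ (2 * l) * y ^ p ^ l) := by
    rw [← aux_trace_pow l (x₀ ^ p ^ l * y), mul_pow, ← pow_mul, ← pow_add, two_mul]
  have e3 : Algebra.trace (ZMod p) F (z • (y ^ p ^ l * x₀) + z • (x₀ ^ p ^ l * y) + β * y) = 0 := by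
    rw [map_add, map_add, map_smul, map_smul, e2, ← aux_trace_pow l (β * y), ← map_smul, ← map_smul,
      ← map_add, ← map_add]
    rw [← map_zero (Algebra.trace (ZMod p) F)]
    congr 1
    simp only [Algebra.smul_def]
    rw [mul_pow]
    linear_combination y ^ p ^ l * h
  have e4 : Algebra.trace (ZMod p) F (β * x₀) = - (2 * z * Algebra.trace (ZMod p) F (x₀ ^ (p ^ l + 1))) := by
    have e5 : (β * x₀) ^ p ^ l = - (z • (x₀ ^ (p ^ l + 1)) ^ p ^ l + z • x₀ ^ (p ^ l + 1)) := by
      simp only [Algebra.smul_def]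
      have : (x₀ ^ (p ^ l + 1)) ^ p ^ l = x₀ ^ p ^ (2 * l) * x₀ ^ p ^ l := by
        rw [two_mul, pow_add p, pow_mul, ← mul_pow, ← pow_succ]
      rw [mul_pow, this, pow_succ x₀]
      linear_combination x₀ ^ p ^ l * h
    rw [← aux_trace_pow l (β * x₀), e5, map_neg, map_add, map_smul, map_smul, aux_trace_pow]
    simp only [smul_eq_mul]; ring
  rw [e1, map_add, map_add, e3, e4, map_add, map_smul, map_smul]
  simp only [smul_eq_mul]; ring

lemma aux_weil (l : ℕ) (z : ZMod p) (β x₀ : F)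
    (h : algebraMap (ZMod p) F z * (x₀ ^ p ^ (2 * l) + x₀) = -β ^ p ^ l) :
    ∑ x : F, ZMod.stdAddChar (Algebra.trace (ZMod p) F
      (algebraMap (ZMod p) F z * x ^ (p ^ l + 1) + β * x)) =
    ZMod.stdAddChar (-(z * Algebra.trace (ZMod p) F (x₀ ^ (p ^ l + 1)))) *
    ∑ x : F, ZMod.stdAddChar (z * Algebra.trace (ZMod p) F (x ^ (p ^ l + 1))) := by
  rw [← Equiv.sum_comp (Equiv.addRight x₀), Finset.mul_sum]
  refine Finset.sum_congr rfl fun y _ => ?_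
  rw [Equiv.coe_addRight, aux_shift l z β x₀ h, ← AddChar.map_add_eq_mul]
  congr 1; ring

/-- S * conj S = q -/
lemma aux_norm (hp : p ≠ 2) (e l n k : ℕ) (hq : Fintype.card F = p ^ e) (hn : Odd n)
    (hk : 2 * l * n = e * k) :
    (∑ x : F, ZMod.stdAddChar (Algebra.trace (ZMod p) F (x ^ (p ^ l + 1)))) *
    (∑ x : F, ZMod.stdAddChar (-Algebra.trace (ZMod p) F (x ^ (p ^ l + 1)))) = (p : ℂ) ^ e := by
  classical
  have key : ∀ h y : F, Algebra.trace (ZMod p) F ((h + y) ^ (p ^ l + 1)) +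
      -Algebra.trace (ZMod p) F (y ^ (p ^ l + 1)) =
      Algebra.trace (ZMod p) F (h ^ (p ^ l + 1)) +
      Algebra.trace (ZMod p) F (y ^ p ^ l * (h ^ p ^ (2 * l) + h)) := by
    intro h y
    have e2 : Algebra.trace (ZMod p) F (h ^ p ^ l * y) =
        Algebra.trace (ZMod p) F (h ^ p ^ (2 * l) * y ^ p ^ l) := by
      rw [← aux_trace_pow l (h ^ p ^ l * y), mul_pow, ← pow_mul, ← pow_add, two_mul]
    have e1 : (h + y) ^ (p ^ l + 1) = h ^ (p ^ l + 1) + h ^ p ^ l * y + y ^ p ^ l * h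
        + y ^ (p ^ l + 1) := by
      rw [pow_succ, aux_pow_add]; ring
    rw [e1, map_add, map_add, map_add, e2, mul_add, map_add, mul_comm (h ^ p ^ (2 * l))]
    ring
  rw [Finset.sum_mul_sum, Finset.sum_comm]
  have : ∀ y : F, ∑ x : F, ZMod.stdAddChar (Algebra.trace (ZMod p) F (x ^ (p ^ l + 1))) *
      ZMod.stdAddChar (-Algebra.trace (ZMod p) F (y ^ (p ^ l + 1))) =
      ∑ h : F, ZMod.stdAddChar (Algebra.trace (ZMod p) F (h ^ (p ^ l + 1))) *
      ZMod.stdAddChar (Algebra.trace (ZMod p) F (y ^ p ^ l * (h ^ p ^ (2 * l) + h))) := by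
    intro y
    rw [← Equiv.sum_comp (Equiv.addRight y)]
    refine Finset.sum_congr rfl fun h _ => ?_
    rw [← AddChar.map_add_eq_mul, ← AddChar.map_add_eq_mul, Equiv.coe_addRight, key]
  simp_rw [this]
  rw [Finset.sum_comm]
  simp_rw [← Finset.mul_sum, aux_sum_pow]
  rw [Finset.sum_eq_single 0]
  · have hp0 : p ≠ 0 := (Fact.out : p.Prime).ne_zero
    simp [hp0, hq]
  · intro h _ hh
    rw [if_neg, mul_zero]
    exact fun h0 => hh (aux_inj hp e l n k hq hn hk h h0)
  · simp

open Classical in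
/-- number of `x` with `Tr(x^(p^l+1)) = t` -/
noncomputable def auxN (p : ℕ) [Fact p.Prime] (F : Type*) [Field F] [Fintype F] [Algebra (ZMod p) F]
    (l : ℕ) (t : ZMod p) : ℕ :=
  (Finset.univ.filter (fun x : F => Algebra.trace (ZMod p) F (x ^ (p ^ l + 1)) = t)).card

open Classical in
lemma aux_units_dvd (N d : ℕ) (h1 : d ∣ Fintype.card F - 1) (h2 : d ∣ N) (P : F → Prop) :
    d ∣ (Finset.univ.filter (fun u : Fˣ => P ((u : F) ^ N))).card := by
  rw [Finset.card_eq_sum_card_fiberwise (f := fun u : Fˣ => u ^ N) (t := Finset.univ)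
    (by intro _ _; simp)]
  refine Finset.dvd_sum fun v _ => ?_
  rw [Finset.filter_filter]
  by_cases hv : v ∈ Set.range (powMonoidHom N : Fˣ →* Fˣ)
  · have h3 := MonoidHom.card_fiber_eq_of_mem_range (powMonoidHom N : Fˣ →* Fˣ) hv
      (y := 1) ⟨1, by simp⟩
    have h4 : (Finset.univ.filter (fun g : Fˣ => powMonoidHom N g = 1)).card
        = (Nat.card Fˣ).gcd N := by
      rw [← IsCyclic.card_powMonoidHom_ker Fˣ N, Nat.card_eq_fintype_card, ← Fintype.card_subtype]
      exact Fintype.card_congr (Equiv.refl _)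
    have h5 : d ∣ (Nat.card Fˣ).gcd N := by
      apply Nat.dvd_gcd _ h2
      rwa [Nat.card_eq_fintype_card, Fintype.card_units]
    by_cases hP : P (v : F)
    · have : (Finset.univ.filter (fun u : Fˣ => P ((u : F) ^ N) ∧ u ^ N = v)) =
          Finset.univ.filter (fun g : Fˣ => powMonoidHom N g = v) := by
        ext u
        simp only [Finset.mem_filter, Finset.mem_univ, true_and, powMonoidHom_apply]
        refine ⟨fun h => h.2, fun h => ⟨?_, h⟩⟩
        rw [← Units.val_pow_eq_pow_val, h]; exact hP
      rw [this, h3, h4]; exact h5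
    · rw [Finset.filter_false_of_mem]
      · simp
      · rintro u _ ⟨ha, hb⟩
        apply hP
        rw [← hb, Units.val_pow_eq_pow_val]; exact ha
  · rw [Finset.filter_false_of_mem]
    · simp
    · rintro u _ ⟨_, hb⟩
      exact hv ⟨u, hb⟩

open Classical in
lemma auxN_eq (l : ℕ) (t : ZMod p) : auxN p F l t = (if t = 0 then 1 else 0) +
    (Finset.univ.filter (fun u : Fˣ =>
      (fun y : F => Algebra.trace (ZMod p) F y = t) ((u : F) ^ (p ^ l + 1)))).card := by
  unfold auxN
  rw [Finset.card_filter, Finset.card_filter]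
  rw [← Finset.add_sum_erase Finset.univ _ (Finset.mem_univ (0 : F))]
  congr 1
  · simp [eq_comm]
  · symm
    refine Finset.sum_bij (fun u _ => (u : F)) ?_ ?_ ?_ ?_
    · intro u _; simp
    · intro u _ v _ h; exact Units.ext h
    · intro x hx
      exact ⟨Units.mk0 x (Finset.ne_of_mem_erase hx), Finset.mem_univ _, rfl⟩
    · intro u _; rfl

lemma aux_delta (e l s n j : ℕ) (hs : 0 < s) (hq : Fintype.card F = p ^ e)
    (he : e = 2 * s * n) (hl : l = s + 2 * s * j) (z : ZMod p) (hz : z ≠ 0) :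
    ∃ δ : F, δ ≠ 0 ∧ δ ^ (p ^ l + 1) = algebraMap (ZMod p) F z := by
  classical
  have hp1 : 1 < p := (Fact.out : p.Prime).one_lt
  have hz' : algebraMap (ZMod p) F z ≠ 0 := by simpa using hz
  obtain ⟨K', hK'⟩ : (p ^ s - 1) * (p ^ s + 1) ∣ p ^ e - 1 := by
    have h1 : (p ^ s - 1) * (p ^ s + 1) = p ^ (2 * s) - 1 := by
      rw [mul_comm, mul_comm 2 s, pow_mul, ← Nat.sq_sub_sq, one_pow]
    rw [h1, he]
    exact Nat.pow_sub_one_dvd_pow_sub_one p (Dvd.intro _ rfl)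
  set v : Fˣ := Units.mk0 _ hz' with hv
  have hps : 1 < p ^ s := Nat.one_lt_pow hs.ne' hp1
  have hv1 : v ^ (p ^ s - 1) = 1 := by
    have : v ^ (p ^ s - 1) * v = v := by
      rw [← pow_succ, Nat.sub_add_cancel hps.le]
      ext
      simp only [Units.val_pow_eq_pow_val, hv, Units.val_mk0]
      exact aux_pow_map s z
    simpa using this
  obtain ⟨g, hg⟩ := IsCyclic.exists_generator (α := Fˣ)
  obtain ⟨i, hi⟩ := (mem_powers_iff_mem_zpowers (x := g)).mpr (hg v)
  have hi : g ^ i = v := hi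
  have ho : orderOf g = p ^ e - 1 := by
    rw [orderOf_eq_card_of_forall_mem_zpowers hg, Nat.card_eq_fintype_card, Fintype.card_units, hq]
  have hd : (p ^ s + 1) * K' ∣ i := by
    rw [← hi, ← pow_mul] at hv1
    have h2 := orderOf_dvd_of_pow_eq_one hv1
    rw [ho, hK', mul_comm i, mul_assoc] at h2
    exact Nat.dvd_of_mul_dvd_mul_left (by omega) h2
  obtain ⟨r, hr⟩ := hd
  have hδ : (g ^ (K' * r)) ^ (p ^ s + 1) = v := by
    rw [← pow_mul, ← hi, hr]; congr 1; ring
  set δ := g ^ (K' * r) with hδ'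
  refine ⟨(δ : F), δ.ne_zero, ?_⟩
  have hfix : δ ^ p ^ (2 * s) = δ := by
    have h1 : p ^ (2 * s) = (p ^ s + 1) * (p ^ s - 1) + 1 := by
      rw [← Nat.sq_sub_sq, mul_comm 2 s, pow_mul, one_pow]
      exact (Nat.sub_add_cancel (Nat.one_le_pow _ _ (by omega))).symm
    rw [h1, pow_succ, pow_mul, hδ, hv1, one_mul]
  have hfix2 : ∀ j, δ ^ p ^ (2 * s * j) = δ := by
    intro j
    induction j with
    | zero => simp
    | succ j ih => rw [Nat.mul_succ, pow_add, pow_mul, ih, hfix]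
  have : δ ^ (p ^ l + 1) = v := by
    rw [pow_succ, hl, add_comm s, pow_add, pow_mul, hfix2, ← pow_succ, hδ]
  rw [← Units.val_pow_eq_pow_val, this]; rfl

lemma aux_delta_sum {δ : F} (l : ℕ) (z : ZMod p)
    (hδ : δ ^ (p ^ l + 1) = algebraMap (ZMod p) F z) (x : F) :
    Algebra.trace (ZMod p) F ((δ * x) ^ (p ^ l + 1)) =
      z * Algebra.trace (ZMod p) F (x ^ (p ^ l + 1)) := by
  rw [mul_pow, hδ, ← Algebra.smul_def, map_smul, smul_eq_mul]

lemma auxN_const (e l s n j : ℕ) (hs : 0 < s) (hq : Fintype.card F = p ^ e)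
    (he : e = 2 * s * n) (hl : l = s + 2 * s * j) (z : ZMod p) (hz : z ≠ 0) :
    auxN p F l z = auxN p F l 1 := by
  classical
  obtain ⟨δ, h0, hδ⟩ := aux_delta (F := F) e l s n j hs hq he hl z hz
  unfold auxN
  symm
  refine Finset.card_bijective (fun x => δ * x) (mulLeft_bijective₀ δ h0) fun x => ?_
  simp only [Finset.mem_filter, Finset.mem_univ, true_and]
  rw [aux_delta_sum l z hδ]
  constructor
  · intro h; rw [h, mul_one]
  · intro h; exact mul_left_cancel₀ hz (by rw [h, mul_one])

lemma aux_S_const (e l s n j : ℕ) (hs : 0 < s) (hq : Fintype.card F = p ^ e)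
    (he : e = 2 * s * n) (hl : l = s + 2 * s * j) (z : ZMod p) (hz : z ≠ 0) :
    ∑ x : F, ZMod.stdAddChar (z * Algebra.trace (ZMod p) F (x ^ (p ^ l + 1))) =
    ∑ x : F, ZMod.stdAddChar (Algebra.trace (ZMod p) F (x ^ (p ^ l + 1))) := by
  obtain ⟨δ, h0, hδ⟩ := aux_delta (F := F) e l s n j hs hq he hl z hz
  refine Fintype.sum_bijective _ (mulLeft_bijective₀ δ h0) _ _ fun x => ?_
  rw [aux_delta_sum l z hδ]

lemma aux_charsum (w : ZMod p) : ∑ t : ZMod p, ZMod.stdAddChar (t * w) =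
    if w = 0 then (p : ℂ) else 0 := by
  have := AddChar.sum_mulShift w (ZMod.isPrimitive_stdAddChar p)
  simpa [ZMod.card] using this

lemma aux_charsum_ne (w : ZMod p) : ∑ t ∈ ({0}ᶜ : Finset (ZMod p)), ZMod.stdAddChar (t * w) =
    (if w = 0 then (p : ℂ) else 0) - 1 := by
  rw [← aux_charsum w, ← Finset.add_sum_erase Finset.univ _ (Finset.mem_univ (0 : ZMod p)),
    Finset.compl_eq_univ_sdiff, Finset.sdiff_singleton_eq_erase]
  simp

lemma aux_S_int (e l s n j : ℕ) (hs : 0 < s) (hq : Fintype.card F = p ^ e)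
    (he : e = 2 * s * n) (hl : l = s + 2 * s * j) :
    ∑ x : F, ZMod.stdAddChar (Algebra.trace (ZMod p) F (x ^ (p ^ l + 1))) =
     (((auxN p F l 0 : ℤ) - auxN p F l 1 : ℤ) : ℂ) := by
  classical
  rw [← Finset.sum_fiberwise (s := Finset.univ)
    (g := fun x : F => Algebra.trace (ZMod p) F (x ^ (p ^ l + 1)))]
  have h1 : ∀ t : ZMod p, ∑ x : F with Algebra.trace (ZMod p) F (x ^ (p ^ l + 1)) = t,
      ZMod.stdAddChar (Algebra.trace (ZMod p) F (x ^ (p ^ l + 1))) =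
      (auxN p F l t : ℂ) * ZMod.stdAddChar t := by
    intro t
    rw [Finset.sum_congr rfl (g := fun _ => ZMod.stdAddChar t)]
    · rw [Finset.sum_const, nsmul_eq_mul, auxN]
    · intro x hx
      rw [(Finset.mem_filter.mp hx).2]
  simp_rw [h1]
  have h2 := aux_charsum_ne (p := p) 1
  rw [if_neg one_ne_zero] at h2
  simp only [mul_one] at h2
  rw [← Finset.add_sum_erase Finset.univ _ (Finset.mem_univ (0 : ZMod p))]
  rw [Finset.compl_eq_univ_sdiff, Finset.sdiff_singleton_eq_erase] at h2
  rw [Finset.sum_congr rfl (g := fun t => (auxN p F l 1 : ℂ) * ZMod.stdAddChar t)]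
  · rw [← Finset.mul_sum, h2]
    simp; ring
  · intro t ht
    rw [auxN_const e l s n j hs hq he hl t (Finset.ne_of_mem_erase ht)]

lemma aux_S (hp : p ≠ 2) (e l s n j : ℕ) (hs : 0 < s) (hq : Fintype.card F = p ^ e)
    (he : e = 2 * s * n) (hl : l = s + 2 * s * j) (hn : Odd n) (z : ZMod p) (hz : z ≠ 0) :
    ∑ x : F, ZMod.stdAddChar (z * Algebra.trace (ZMod p) F (x ^ (p ^ l + 1))) =
      -(p : ℂ) ^ (s * n) := by
  classical
  have hp1 : 1 < p := (Fact.out : p.Prime).one_lt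
  have hneg := aux_S_const (F := F) e l s n j hs hq he hl (-1) (neg_ne_zero.mpr one_ne_zero)
  simp only [neg_one_mul] at hneg
  have hnorm := aux_norm (F := F) hp e l n (1 + 2 * j) hq hn (by rw [he, hl]; ring)
  rw [hneg] at hnorm
  rw [aux_S_const (F := F) e l s n j hs hq he hl z hz]
  rw [aux_S_int (F := F) e l s n j hs hq he hl] at hnorm ⊢
  set A : ℤ := (auxN p F l 0 : ℤ) - auxN p F l 1 with hA
  have hsq : A * A = (p : ℤ) ^ e := by exact_mod_cast hnorm
  have hd1 : p ^ s + 1 ∣ Fintype.card F - 1 := by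
    have h1 : (p ^ s - 1) * (p ^ s + 1) = p ^ (2 * s) - 1 := by
      rw [mul_comm, mul_comm 2 s, pow_mul, ← Nat.sq_sub_sq, one_pow]
    rw [hq, he]
    refine dvd_trans (Dvd.intro_left _ h1) (Nat.pow_sub_one_dvd_pow_sub_one p (Dvd.intro _ rfl))
  have hd2 : p ^ s + 1 ∣ p ^ l + 1 := by
    have : Odd (1 + 2 * j) := ⟨j, by ring⟩
    have h := this.nat_add_dvd_pow_add_pow (p ^ s) 1
    rw [← pow_mul, one_pow] at h
    rw [hl]; convert h using 3; ring
  have hmod : ((p ^ s + 1 : ℕ) : ℤ) ∣ A - 1 := by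
    rw [hA, auxN_eq, auxN_eq, if_pos rfl, if_neg one_ne_zero]
    have h1 := aux_units_dvd (F := F) (p ^ l + 1) (p ^ s + 1) hd1 hd2
      (fun y => Algebra.trace (ZMod p) F y = 0)
    have h2 := aux_units_dvd (F := F) (p ^ l + 1) (p ^ s + 1) hd1 hd2
      (fun y => Algebra.trace (ZMod p) F y = 1)
    have h3 := dvd_sub (Int.natCast_dvd_natCast.mpr h1) (Int.natCast_dvd_natCast.mpr h2)
    refine h3.trans (dvd_of_eq ?_)
    push_cast
    simp only [zero_add]
    ring_nf
  have hmod2 : ((p ^ s + 1 : ℕ) : ℤ) ∣ (p : ℤ) ^ (s * n) + 1 := by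
    have h := hn.nat_add_dvd_pow_add_pow (p ^ s) 1
    rw [← pow_mul, one_pow] at h
    exact_mod_cast h
  have hcase : A = (p : ℤ) ^ (s * n) ∨ A = -(p : ℤ) ^ (s * n) := by
    apply mul_self_eq_mul_self_iff.mp
    rw [hsq, ← pow_add, he]; congr 1; ring
  rcases hcase with h | h
  · exfalso
    have h2 : ((p ^ s + 1 : ℕ) : ℤ) ∣ 2 := by
      have := dvd_sub hmod2 hmod
      rw [h] at this
      have h4 : (p : ℤ) ^ (s * n) + 1 - ((p : ℤ) ^ (s * n) - 1) = 2 := by ring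
      rwa [h4] at this
    have h5 : p ^ s + 1 ∣ 2 := by exact_mod_cast h2
    have h3 := Nat.le_of_dvd (by norm_num) h5
    have hps : 1 < p ^ s := Nat.one_lt_pow hs.ne' hp1
    omega
  · rw [h]; push_cast; ring


lemma aux_gval (T c : ZMod p) :
    ∑ z1 ∈ ({0}ᶜ : Finset (ZMod p)), ∑ z2 ∈ ({0}ᶜ : Finset (ZMod p)),
      (ZMod.stdAddChar (-z1 - c * z2 - z1⁻¹ * z2 ^ 2 * T) : ℂ) =
    ∑ w ∈ ({0}ᶜ : Finset (ZMod p)), ((if 1 + c * w + T * w ^ 2 = 0 then (p : ℂ) else 0) - 1) := by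
  have h1 : ∀ z1 ∈ ({0}ᶜ : Finset (ZMod p)), ∑ z2 ∈ ({0}ᶜ : Finset (ZMod p)),
      (ZMod.stdAddChar (-z1 - c * z2 - z1⁻¹ * z2 ^ 2 * T) : ℂ) =
      ∑ w ∈ ({0}ᶜ : Finset (ZMod p)),
        ZMod.stdAddChar (z1 * (-(1 + c * w + T * w ^ 2))) := by
    intro z1 hz1
    have hz : z1 ≠ 0 := by simpa using hz1
    symm
    refine Finset.sum_bij (fun w _ => z1 * w) ?_ ?_ ?_ ?_
    · intro w hw; simpa [hz] using hw
    · intro w _ w' _ h; exact mul_left_cancel₀ hz h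
    · intro y hy
      exact ⟨z1⁻¹ * y, by simpa [hz] using hy, by rw [mul_inv_cancel_left₀ hz]⟩
    · intro w _
      congr 1
      field_simp
      ring
  rw [Finset.sum_congr rfl h1, Finset.sum_comm]
  refine Finset.sum_congr rfl fun w _ => ?_
  rw [aux_charsum_ne]
  simp only [neg_eq_zero]

lemma aux_g_neg (T c : ZMod p) :
    ∑ w ∈ ({0}ᶜ : Finset (ZMod p)), ((if 1 + (-c) * w + T * w ^ 2 = 0 then (p : ℂ) else 0) - 1) =
    ∑ w ∈ ({0}ᶜ : Finset (ZMod p)), ((if 1 + c * w + T * w ^ 2 = 0 then (p : ℂ) else 0) - 1) := by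
  refine Finset.sum_equiv (Equiv.neg (ZMod p)) (by simp) fun w _ => ?_
  simp

lemma aux_card_ne : (({0}ᶜ : Finset (ZMod p)).card : ℂ) = (p : ℂ) - 1 := by
  rw [Finset.card_compl, ZMod.card, Finset.card_singleton,
    Nat.cast_sub (Fact.out : p.Prime).one_lt.le, Nat.cast_one]

lemma aux_g_total (T : ZMod p) :
    ∑ c ∈ ({0}ᶜ : Finset (ZMod p)), ∑ w ∈ ({0}ᶜ : Finset (ZMod p)),
      ((if 1 + c * w + T * w ^ 2 = 0 then (p : ℂ) else 0) - 1) =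
    ((p : ℂ) - 1) - p * ((Finset.univ.filter (fun w : ZMod p => 1 + T * w ^ 2 = 0)).card : ℂ) := by
  rw [Finset.sum_comm]
  have h1 : ∀ w ∈ ({0}ᶜ : Finset (ZMod p)), ∑ c ∈ ({0}ᶜ : Finset (ZMod p)),
      ((if 1 + c * w + T * w ^ 2 = 0 then (p : ℂ) else 0) - 1) =
      1 - (if 1 + T * w ^ 2 = 0 then (p : ℂ) else 0) := by
    intro w hw
    have hw : w ≠ 0 := by simpa using hw
    rw [Finset.sum_sub_distrib, Finset.sum_const, nsmul_eq_mul, aux_card_ne]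
    have h2 : ∀ c : ZMod p, (1 + c * w + T * w ^ 2 = 0) ↔ c = -(1 + T * w ^ 2) * w⁻¹ := by
      intro c
      rw [eq_mul_inv_iff_mul_eq₀ hw]
      constructor
      · intro h; linear_combination h
      · intro h; linear_combination h
    simp_rw [h2]
    rw [Finset.sum_ite_eq']
    by_cases h3 : 1 + T * w ^ 2 = 0
    · rw [if_pos h3, if_neg]
      · ring
      · simp [h3]
    · rw [if_neg h3, if_pos]
      · ring
      · simp [hw, neg_eq_zero, h3, -neg_add_rev]
  rw [Finset.sum_congr rfl h1, Finset.sum_sub_distrib, Finset.sum_const, nsmul_eq_mul, aux_card_ne,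
    mul_one, ← Finset.sum_filter, Finset.sum_const, nsmul_eq_mul, mul_comm (p : ℂ)]
  congr 4
  ext w
  simp only [Finset.mem_filter, Finset.mem_compl, Finset.mem_singleton, Finset.mem_univ, true_and]
  constructor
  · exact fun h => h.2
  · refine fun h => ⟨?_, h⟩
    rintro rfl
    simp at h

lemma aux_half (hp : p % 4 = 3) (f : ZMod p → ℂ) (hf : ∀ c, f (-c) = f c) (i : ℕ) (hi : i ≤ 1) :
    ∑ c ∈ cyc p i, f c = (∑ c ∈ ({0}ᶜ : Finset (ZMod p)), f c) / 2 := by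
  classical
  have hns : ¬ IsSquare (-1 : ZMod p) := by
    rw [ZMod.exists_sq_eq_neg_one_iff]; simp [hp]
  have hneg : ∀ x : ZMod p, x ≠ 0 → (IsSquare (-x) ↔ ¬ IsSquare x) := by
    intro x hx
    constructor
    · rintro h1 h2
      apply hns
      have := h1.div h2
      rwa [neg_div, div_self hx] at this
    · intro h
      have h1 : quadraticChar (ZMod p) (-x) = 1 := by
        rw [← neg_one_mul, map_mul, quadraticChar_neg_one_iff_not_isSquare.mpr h,
          quadraticChar_neg_one_iff_not_isSquare.mpr hns]
        norm_num
      exact (quadraticChar_one_iff_isSquare (neg_ne_zero.mpr hx)).mp h1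
  have h01 : ∑ c ∈ cyc p 0, f c = ∑ c ∈ cyc p 1, f c := by
    refine Finset.sum_equiv (Equiv.neg (ZMod p)) ?_ fun w _ => ?_
    · intro x
      simp only [cyc, Finset.mem_filter, Finset.mem_univ, true_and, Equiv.neg_apply, if_true,
        one_ne_zero, if_false, neg_ne_zero]
      constructor
      · rintro ⟨h1, h2⟩
        exact ⟨h1, fun h => (hneg x h1).mp h h2⟩
      · rintro ⟨h1, h2⟩
        refine ⟨h1, ?_⟩
        by_contra h
        exact h2 ((hneg x h1).mpr h)
    · simp [hf]
  have hsum : ∑ c ∈ cyc p 0, f c + ∑ c ∈ cyc p 1, f c = ∑ c ∈ ({0}ᶜ : Finset (ZMod p)), f c := by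
    rw [← Finset.sum_filter_add_sum_filter_not ({0}ᶜ : Finset (ZMod p)) (fun x => IsSquare x)]
    congr 1
    · refine Finset.sum_congr ?_ fun _ _ => rfl
      ext x; simp [cyc]
    · refine Finset.sum_congr ?_ fun _ _ => rfl
      ext x; simp [cyc]
  interval_cases i
  · rw [← hsum, ← h01]; ring
  · rw [← hsum, h01]; ring

lemma aux_roots_zero (hp : p % 4 = 3) (T : ZMod p) (h : IsSquare T) :
    (Finset.univ.filter (fun w : ZMod p => 1 + T * w ^ 2 = 0)).card = 0 := by
  have hns : ¬ IsSquare (-1 : ZMod p) := by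
    rw [ZMod.exists_sq_eq_neg_one_iff]; simp [hp]
  rw [Finset.card_eq_zero, Finset.filter_eq_empty_iff]
  intro w _ h1
  apply hns
  obtain ⟨r, rfl⟩ := h
  exact ⟨r * w, by linear_combination -h1⟩

lemma aux_roots_two (hp : p % 4 = 3) (T : ZMod p) (h : ¬ IsSquare T) :
    (Finset.univ.filter (fun w : ZMod p => 1 + T * w ^ 2 = 0)).card = 2 := by
  have hns : ¬ IsSquare (-1 : ZMod p) := by
    rw [ZMod.exists_sq_eq_neg_one_iff]; simp [hp]
  have hT : T ≠ 0 := by rintro rfl; exact h (IsSquare.zero)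
  have h1 : IsSquare (-T) := by
    have h1 : quadraticChar (ZMod p) (-T) = 1 := by
      rw [← neg_one_mul, map_mul, quadraticChar_neg_one_iff_not_isSquare.mpr h,
        quadraticChar_neg_one_iff_not_isSquare.mpr hns]
      norm_num
    exact (quadraticChar_one_iff_isSquare (neg_ne_zero.mpr hT)).mp h1
  obtain ⟨r, hr⟩ := h1
  have hr0 : r ≠ 0 := by
    rintro rfl
    simp at hr; exact hT hr
  have h2 : (2 : ZMod p) ≠ 0 := by
    apply Ring.two_ne_zero
    rw [ZMod.ringChar_zmod_n]
    omega
  rw [Finset.card_eq_two]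
  refine ⟨r⁻¹, -r⁻¹, ?_, ?_⟩
  · intro h3
    have : (2 : ZMod p) * r⁻¹ = 0 := by linear_combination h3
    simp [h2, hr0] at this
  · ext w
    simp only [Finset.mem_filter, Finset.mem_univ, true_and, Finset.mem_insert,
      Finset.mem_singleton]
    have hT' : T = -(r * r) := by rw [← hr, neg_neg]
    rw [hT']
    constructor
    · intro h3
      have h4 : (r * w - 1) * (r * w + 1) = 0 := by linear_combination -h3
      rcases mul_eq_zero.mp h4 with h5 | h5
      · left; exact eq_inv_of_mul_eq_one_right (by linear_combination h5)
      · right; rw [← neg_eq_iff_eq_neg]; exact eq_inv_of_mul_eq_one_right (by linear_combination -h5)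
    · rintro (rfl | rfl)
      · field_simp; ring
      · field_simp; ring

lemma aux_zeta (v : ZMod p) : zetaP p ^ v.val = ZMod.stdAddChar v := by
  have h := ZMod.stdAddChar_coe (N := p) (v.val : ℤ)
  rw [Int.cast_natCast, ZMod.natCast_zmod_val] at h
  rw [h, zetaP, ← Complex.exp_nat_mul]
  congr 1
  push_cast
  ring

lemma aux_psi (hp : p % 4 = 3) (e l s n j : ℕ) (hs : 0 < s) (hn : Odd n)
    (he : e = 2 * s * n) (hl : l = s + 2 * s * j) (a γ : GaloisField p e) (b : ZMod p)
    (hγ : γ ^ p ^ (2 * l) + γ = -a ^ p ^ l) (i : ℕ) (hi : i ≤ 1) :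
    psi4 p e l i a b = (p : ℂ) ^ ((e : ℤ) - 3) * (-(p : ℂ) ^ (s * n) *
      ((((p : ℂ) - 1) - p * ((Finset.univ.filter
        (fun w : ZMod p => 1 + (b⁻¹ ^ 2 * tr p e (γ ^ (p ^ l + 1))) * w ^ 2 = 0)).card : ℂ)) / 2)) := by
  letI : Fintype (GaloisField p e) := Fintype.ofFinite _
  have hp2 : p ≠ 2 := by rintro rfl; omega
  have he0 : e ≠ 0 := by
    rw [he]; have := hn.pos; positivity
  have hq : Fintype.card (GaloisField p e) = p ^ e := by
    rw [← Nat.card_eq_fintype_card, GaloisField.card p e he0]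
  set T := tr p e (γ ^ (p ^ l + 1)) with hT
  have hw : ∀ z1 : ZMod p, z1 ≠ 0 → ∀ z2 : ZMod p,
      weilSum p e l (algebraMap (ZMod p) (GaloisField p e) z1)
          (-a * algebraMap (ZMod p) (GaloisField p e) (b⁻¹ * z2)) =
      ZMod.stdAddChar (-(z1⁻¹ * z2 ^ 2 * (b⁻¹ ^ 2 * T))) * -(p : ℂ) ^ (s * n) := by
    intro z1 hz1 z2
    have hmul : ∀ (k : ZMod p) (r : ℕ), (algebraMap (ZMod p) (GaloisField p e) k * γ) ^ p ^ r =
        algebraMap (ZMod p) (GaloisField p e) k * γ ^ p ^ r := by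
      intro k r; rw [mul_pow, aux_pow_map]
    have h := aux_weil (F := GaloisField p e) l z1
      (-a * algebraMap (ZMod p) (GaloisField p e) (b⁻¹ * z2))
      (algebraMap (ZMod p) (GaloisField p e) (-(z1⁻¹ * (b⁻¹ * z2))) * γ) (by
        rw [hmul, ← mul_add, hγ, mul_pow, aux_pow_map, aux_pow_neg, ← mul_assoc, ← map_mul]
        have : z1 * -(z1⁻¹ * (b⁻¹ * z2)) = -(b⁻¹ * z2) := by field_simp
        rw [this, map_neg]
        ring)
    rw [aux_S (F := GaloisField p e) hp2 e l s n j hs hq he hl hn z1 hz1] at h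
    unfold weilSum
    simp_rw [aux_zeta]
    refine Eq.trans h ?_
    congr 2
    rw [mul_pow, ← map_pow, ← Algebra.smul_def, map_smul, smul_eq_mul]
    change -(z1 * (_ * T)) = _
    rw [pow_succ, ZMod.pow_card_pow]
    field_simp
  unfold psi4
  congr 1
  simp_rw [aux_zeta]
  have h1 : ∀ c ∈ cyc p i, (∑ z1 ∈ ({0}ᶜ : Finset (ZMod p)), ZMod.stdAddChar (-z1) *
      ∑ z2 ∈ ({0}ᶜ : Finset (ZMod p)), ZMod.stdAddChar (-(c * z2)) *
        weilSum p e l (algebraMap (ZMod p) (GaloisField p e) z1)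
          (-a * algebraMap (ZMod p) (GaloisField p e) (b⁻¹ * z2))) =
      -(p : ℂ) ^ (s * n) * ∑ w ∈ ({0}ᶜ : Finset (ZMod p)),
        ((if 1 + c * w + (b⁻¹ ^ 2 * T) * w ^ 2 = 0 then (p : ℂ) else 0) - 1) := by
    intro c _
    rw [← aux_gval, Finset.mul_sum]
    refine Finset.sum_congr rfl fun z1 hz1 => ?_
    rw [Finset.mul_sum, Finset.mul_sum]
    refine Finset.sum_congr rfl fun z2 _ => ?_
    rw [hw z1 (by simpa using hz1) z2, sub_eq_add_neg, sub_eq_add_neg, AddChar.map_add_eq_mul,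
      AddChar.map_add_eq_mul]
    ring
  rw [Finset.sum_congr rfl h1, ← Finset.mul_sum,
    aux_half hp _ (fun c => aux_g_neg _ c) i hi, aux_g_total]

end helpers

/-- the value of `ψ_4^{(i)}(a, b)` for `a ≠ 0`, `b ∈ F_p^*`,
when `m/s` is odd (paper Lemma 13). -/
theorem psi4_eval_odd (p e l m s : ℕ) [Fact p.Prime] (hp : p % 4 = 3)
    (hl : 0 < l) (hm : 1 ≤ m) (he : e = 2 * m) (hs : s = Nat.gcd l e)
    (hsm : s ∣ m) (hodd : Odd (m / s)) (a : GaloisField p e) (ha : a ≠ 0)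
    (b : ZMod p) (hb : b ≠ 0) :
    (∃! γ : GaloisField p e, γ ^ p ^ (2 * l) + γ = -a ^ p ^ l) ∧
    ∀ γ : GaloisField p e, γ ^ p ^ (2 * l) + γ = -a ^ p ^ l →
      ∀ i ≤ 1,
        ((tr p e (γ ^ (p ^ l + 1)) = 0 ∨ tr p e (γ ^ (p ^ l + 1)) ∈ cyc p 0) →
          psi4 p e l i a b = -(((p : ℂ) - 1) / 2) * (p : ℂ) ^ ((e : ℤ) + m - 3)) ∧
        (tr p e (γ ^ (p ^ l + 1)) ∈ cyc p 1 →
          psi4 p e l i a b = ((p : ℂ) + 1) / 2 * (p : ℂ) ^ ((e : ℤ) + m - 3)) := by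
  have hs0 : 0 < s := by rw [hs]; exact Nat.gcd_pos_of_pos_left _ hl
  obtain ⟨n, rfl⟩ := hsm
  rw [Nat.mul_div_cancel_left _ hs0] at hodd
  have he' : e = 2 * s * n := by rw [he]; ring
  obtain ⟨r, hr⟩ : s ∣ l := by rw [hs]; exact Nat.gcd_dvd_left _ _
  have hrodd : Odd r := by
    by_contra h
    rw [Nat.not_odd_iff_even] at h
    obtain ⟨k, hk⟩ := h
    have h1 : s * 2 ∣ Nat.gcd l e := by
      apply Nat.dvd_gcd
      · exact ⟨k, by rw [hr, hk]; ring⟩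
      · exact ⟨n, by rw [he']; ring⟩
    rw [← hs] at h1
    have := Nat.le_of_dvd hs0 h1
    omega
  obtain ⟨j, hj⟩ := hrodd
  have hl' : l = s + 2 * s * j := by rw [hr, hj]; ring
  have hp2 : p ≠ 2 := by rintro rfl; omega
  have hp0 : (p : ℂ) ≠ 0 := by exact_mod_cast (Fact.out : p.Prime).ne_zero
  have he0 : e ≠ 0 := by
    rw [he]; omega
  letI : Fintype (GaloisField p e) := Fintype.ofFinite _
  have hq : Fintype.card (GaloisField p e) = p ^ e := by
    rw [← Nat.card_eq_fintype_card, GaloisField.card p e he0]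
  have hbij := aux_bij (F := GaloisField p e) hp2 e l n (1 + 2 * j) hq hodd
    (by rw [he', hl']; ring)
  refine ⟨hbij.existsUnique _, ?_⟩
  intro γ hγ i hi
  have hpsi := aux_psi hp e l s n j hs0 hodd he' hl' a γ b hγ i hi
  have hpow : (p : ℂ) ^ ((e : ℤ) + (s * n : ℕ) - 3) = (p : ℂ) ^ ((e : ℤ) - 3) * (p : ℂ) ^ (s * n) := by
    rw [add_sub_right_comm, zpow_add₀ hp0, zpow_natCast]
  have hbsq : IsSquare (b⁻¹ ^ 2) := ⟨b⁻¹, by ring⟩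
  rw [hpow]
  constructor
  · intro hT
    have hsq : IsSquare (tr p e (γ ^ (p ^ l + 1))) := by
      rcases hT with h | h
      · rw [h]; exact IsSquare.zero
      · simpa [cyc] using (Finset.mem_filter.mp h).2.2
    rw [hpsi, aux_roots_zero hp _ (hbsq.mul hsq)]
    push_cast; ring
  · intro hT
    have hnsq : ¬ IsSquare (tr p e (γ ^ (p ^ l + 1))) := by
      simpa [cyc] using (Finset.mem_filter.mp hT).2.2
    have hnsq' : ¬ IsSquare (b⁻¹ ^ 2 * tr p e (γ ^ (p ^ l + 1))) := by
      intro h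
      apply hnsq
      have h2 := h.div hbsq
      rwa [mul_div_cancel_left₀ _ (pow_ne_zero 2 (inv_ne_zero hb))] at h2
    rw [hpsi, aux_roots_two hp _ hnsq']
    push_cast; ring

end
end
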